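/- Assume Σ_{l=1}^L γ_l M_l < |N| and that all mobiles are collocated: h_{lj} = h_j > 0 for all classes l and base stations j. Define tolled cost densities c̄_{lj}(m) = g_{lj}/(1 − m_j) + γ_l Σ_{i=1}^L m_{ij} g_{ij} / (1 − m_j)² for m_j < 1 (and +∞ otherwise). Then the system cost C(m) = Σ_{j ∈ N} Σ_{l=1}^L m_{lj} g_{lj}/(1 − m_j) is convex on the set of congestion profiles with m_j < 1 for all j, and every Nash equilibrium of the tolled game (i.e., every congestion profile m such that m_{lj} > 0 implies c̄_{lj}(m) ≤ c̄_{lk}(m) for all k) is system optimal. -/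

import Mathlib

open scoped BigOperators ENNReal

/-- `m` is a congestion profile: nonnegative entries, class `l` has total mass `Ml l`. -/
def IsProfile {L N : Type*} [Fintype N] (Ml : L → ℝ) (m : L → N → ℝ) : Prop :=
  (∀ l j, 0 ≤ m l j) ∧ ∀ l, (∑ j, m l j) = Ml l

/-- Congestion `m_j = ∑_l γ_l m_{lj}` at base station `j`. -/
noncomputable def cong {L N : Type*} [Fintype L] (γ : L → ℝ) (m : L → N → ℝ) (j : N) : ℝ :=
  ∑ l, γ l * m l j

/-- The constant `g_{lj} = γ_l σ² / h_{lj}`. -/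
noncomputable def gq {L N : Type*} (σ2 : ℝ) (γ : L → ℝ) (h : L → N → ℝ) (l : L) (j : N) : ℝ :=
  γ l * σ2 / h l j

/-- Cost density of class `l` at base station `j`: `g_{lj}/(1 − m_j)` if `m_j < 1`,
and `+∞` otherwise. -/
noncomputable def cd {L N : Type*} [Fintype L] (σ2 : ℝ) (γ : L → ℝ) (h : L → N → ℝ)
    (m : L → N → ℝ) (l : L) (j : N) : ℝ≥0∞ :=
  if cong γ m j < 1 then ENNReal.ofReal (gq σ2 γ h l j / (1 - cong γ m j)) else ⊤

/-- `m` is a Nash equilibrium of the nonatomic association game: whenever class `l` has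
positive mass at base station `j`, `j` has minimal cost density for class `l`. -/
def IsNE {L N : Type*} [Fintype L] (σ2 : ℝ) (γ : L → ℝ) (h : L → N → ℝ)
    (m : L → N → ℝ) : Prop :=
  ∀ (l : L) (j k : N), 0 < m l j → cd σ2 γ h m l j ≤ cd σ2 γ h m l k

/-- Real-valued system cost `C(m) = ∑_j ∑_l m_{lj} g_{lj}/(1 − m_j)` (used on the region
where `m_j < 1` for all `j`). -/
noncomputable def Creal {L N : Type*} [Fintype L] [Fintype N]
    (σ2 : ℝ) (γ : L → ℝ) (h : L → N → ℝ) (m : L → N → ℝ) : ℝ :=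
  ∑ j, ∑ l, m l j * gq σ2 γ h l j / (1 - cong γ m j)

/-- System cost with values in `ℝ≥0∞`: `+∞` as soon as some base station `j` has
`m_j ≥ 1` and carries positive mass. -/
noncomputable def CsysE {L N : Type*} [Fintype L] [Fintype N]
    (σ2 : ℝ) (γ : L → ℝ) (h : L → N → ℝ) (m : L → N → ℝ) : ℝ≥0∞ :=
  ∑ j, ∑ l, ENNReal.ofReal (m l j) * cd σ2 γ h m l j

/-- Tolled cost density `c̄_{lj}(m) = g_{lj}/(1 − m_j) + γ_l ∑_i m_{ij} g_{ij}/(1 − m_j)²`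
when `m_j < 1`, and `+∞` otherwise. -/
noncomputable def cbarE {L N : Type*} [Fintype L]
    (σ2 : ℝ) (γ : L → ℝ) (h : L → N → ℝ) (m : L → N → ℝ) (l : L) (j : N) : ℝ≥0∞ :=
  if cong γ m j < 1 then
    ENNReal.ofReal (gq σ2 γ h l j / (1 - cong γ m j) +
      γ l * (∑ i, m i j * gq σ2 γ h i j) / (1 - cong γ m j) ^ 2)
  else ⊤

/-- Tangent line inequality for `x / (1 - x)`. -/
lemma tangent_aux (x y : ℝ) (hx : x < 1) (hy : y < 1) :
    x / (1 - x) + 1 / (1 - x) ^ 2 * (y - x) ≤ y / (1 - y) := by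
  have h1 : 0 < 1 - x := by linarith
  have h2 : 0 < 1 - y := by linarith
  have : y / (1 - y) - (x / (1 - x) + 1 / (1 - x) ^ 2 * (y - x))
      = (y - x) ^ 2 / ((1 - x) ^ 2 * (1 - y)) := by
    field_simp
    ring
  have h3 : 0 ≤ (y - x) ^ 2 / ((1 - x) ^ 2 * (1 - y)) := by positivity
  linarith

lemma convex_aux (x y s t : ℝ) (hx : x < 1) (hy : y < 1) (hs : 0 ≤ s) (ht : 0 ≤ t)
    (hst : s + t = 1) :
    (s * x + t * y) / (1 - (s * x + t * y)) ≤ s * (x / (1 - x)) + t * (y / (1 - y)) := by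
  have hz : s * x + t * y < 1 := by
    rcases hs.eq_or_lt with h | h
    · subst h
      have : t = 1 := by linarith
      subst this
      linarith
    · nlinarith
  have h1 := mul_le_mul_of_nonneg_left (tangent_aux _ x hz hx) hs
  have h2 := mul_le_mul_of_nonneg_left (tangent_aux _ y hz hy) ht
  set z := s * x + t * y with hzd
  have e : s * (z / (1 - z) + 1 / (1 - z) ^ 2 * (x - z))
      + t * (z / (1 - z) + 1 / (1 - z) ^ 2 * (y - z))
      = (s + t) * (z / (1 - z)) + 1 / (1 - z) ^ 2 * (s * x + t * y - (s + t) * z) := by ring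
  rw [hst, ← hzd] at e
  have e2 : 1 / (1 - z) ^ 2 * (z - 1 * z) = 0 := by ring
  linarith

lemma Creal_aux {L N : Type*} [Fintype L] [Fintype N]
    (σ2 : ℝ) (γ : L → ℝ) (hb : N → ℝ) (m : L → N → ℝ) :
    Creal σ2 γ (fun _ j => hb j) m
      = ∑ j, σ2 / hb j * (cong γ m j / (1 - cong γ m j)) := by
  unfold Creal
  refine Finset.sum_congr rfl fun j _ => ?_
  rw [← Finset.sum_div, ← mul_div_assoc]
  congr 1
  unfold cong gq
  rw [Finset.mul_sum]
  refine Finset.sum_congr rfl fun l _ => ?_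
  ring

lemma cong_sum_aux {L N : Type*} [Fintype L] [Fintype N]
    (γ Ml : L → ℝ) (m : L → N → ℝ) (hm : IsProfile Ml m) :
    ∑ j, cong γ m j = ∑ l, γ l * Ml l := by
  unfold cong
  rw [Finset.sum_comm]
  refine Finset.sum_congr rfl fun l _ => ?_
  rw [← Finset.mul_sum, hm.2 l]

lemma cong_nonneg_aux {L N : Type*} [Fintype L] [Fintype N]
    (γ Ml : L → ℝ) (hγ : ∀ l, 0 < γ l) (m : L → N → ℝ) (hm : IsProfile Ml m) (j : N) :
    0 ≤ cong γ m j :=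
  Finset.sum_nonneg fun l _ => mul_nonneg (hγ l).le (hm.1 l j)

lemma cong_pos_aux {L N : Type*} [Fintype L] [Fintype N]
    (γ : L → ℝ) (hγ : ∀ l, 0 < γ l) (m : L → N → ℝ) (j : N)
    (hj : 0 < cong γ m j) : ∃ l, 0 < m l j := by
  by_contra! hc
  have : cong γ m j ≤ 0 :=
    Finset.sum_nonpos fun l _ => mul_nonpos_of_nonneg_of_nonpos (hγ l).le (hc l)
  linarith

lemma cbar_aux {L N : Type*} [Fintype L]
    (σ2 : ℝ) (γ : L → ℝ) (hb : N → ℝ) (m : L → N → ℝ) (l : L) (j : N)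
    (hj : cong γ m j < 1) :
    cbarE σ2 γ (fun _ j => hb j) m l j
      = ENNReal.ofReal (γ l * (σ2 / hb j * (1 / (1 - cong γ m j) ^ 2))) := by
  unfold cbarE
  rw [if_pos hj]
  congr 1
  have e : ∑ i, m i j * gq σ2 γ (fun _ j => hb j) i j = σ2 / hb j * cong γ m j := by
    unfold cong gq
    rw [Finset.mul_sum]
    refine Finset.sum_congr rfl fun l _ => ?_
    ring
  rw [e]
  unfold gq
  have h1 : 1 - cong γ m j ≠ 0 := by linarith
  generalize cong γ m j = x at *
  rw [mul_div_assoc]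
  generalize σ2 / hb j = a
  field_simp
  ring

lemma CsysE_aux {L N : Type*} [Fintype L] [Fintype N]
    (σ2 : ℝ) (hσ : 0 < σ2) (γ Ml : L → ℝ) (hγ : ∀ l, 0 < γ l)
    (hb : N → ℝ) (hhb : ∀ j, 0 < hb j) (m : L → N → ℝ) (hm : IsProfile Ml m)
    (hj : ∀ j, cong γ m j < 1) :
    CsysE σ2 γ (fun _ j => hb j) m = ENNReal.ofReal (Creal σ2 γ (fun _ j => hb j) m) := by
  have hnn : ∀ j l, 0 ≤ m l j * gq σ2 γ (fun _ j => hb j) l j / (1 - cong γ m j) := by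
    intro j l
    have h1 : 0 < 1 - cong γ m j := by linarith [hj j]
    have h2 := hm.1 l j
    have h3 := hγ l
    have h4 := hhb j
    unfold gq
    positivity
  unfold CsysE Creal
  rw [ENNReal.ofReal_sum_of_nonneg fun j _ => Finset.sum_nonneg fun l _ => hnn j l]
  refine Finset.sum_congr rfl fun j _ => ?_
  rw [ENNReal.ofReal_sum_of_nonneg fun l _ => hnn j l]
  refine Finset.sum_congr rfl fun l _ => ?_
  unfold cd
  rw [if_pos (hj j), ← ENNReal.ofReal_mul (hm.1 l j), mul_div_assoc]

lemma CsysE_top_aux {L N : Type*} [Fintype L] [Fintype N]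
    (σ2 : ℝ) (γ : L → ℝ) (hγ : ∀ l, 0 < γ l)
    (h : L → N → ℝ) (m : L → N → ℝ) (j : N)
    (hj : 1 ≤ cong γ m j) :
    CsysE σ2 γ h m = ⊤ := by
  obtain ⟨l, hl⟩ := cong_pos_aux γ hγ m j (by linarith)
  unfold CsysE
  refine ENNReal.sum_eq_top.2 ⟨j, Finset.mem_univ _, ENNReal.sum_eq_top.2 ⟨l, Finset.mem_univ _, ?_⟩⟩
  unfold cd
  rw [if_neg (not_lt.2 hj)]
  exact ENNReal.mul_top (by simpa using hl)

/-- Under feasibility `∑_l γ_l M_l < |N|` and collocated mobiles (`h_{lj} = h_j`): the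
system cost is convex on the set of congestion profiles with `m_j < 1` for all `j`, and
every Nash equilibrium of the tolled game is system optimal. -/
theorem nonatomic_tolls_strongly_enforce_collocated {L N : Type*} [Fintype L] [Fintype N]
    (σ2 : ℝ) (hσ : 0 < σ2) (γ Ml : L → ℝ) (hγ : ∀ l, 0 < γ l) (hMl : ∀ l, 0 < Ml l)
    (hb : N → ℝ) (hhb : ∀ j, 0 < hb j)
    (hfeas : (∑ l, γ l * Ml l) < Fintype.card N) :
    ConvexOn ℝ {m : L → N → ℝ | IsProfile Ml m ∧ ∀ j, cong γ m j < 1}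
      (Creal σ2 γ (fun _ j => hb j)) ∧
    (∀ m : L → N → ℝ, IsProfile Ml m →
      (∀ (l : L) (j k : N), 0 < m l j →
        cbarE σ2 γ (fun _ j => hb j) m l j ≤ cbarE σ2 γ (fun _ j => hb j) m l k) →
      ∀ m' : L → N → ℝ, IsProfile Ml m' →
        CsysE σ2 γ (fun _ j => hb j) m ≤ CsysE σ2 γ (fun _ j => hb j) m') := by
  constructor
  · have hcomb : ∀ (x y : L → N → ℝ) (s t : ℝ) (j : N),
        cong γ (s • x + t • y) j = s * cong γ x j + t * cong γ y j := by
      intro x y s t j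
      unfold cong
      rw [Finset.mul_sum, Finset.mul_sum, ← Finset.sum_add_distrib]
      refine Finset.sum_congr rfl fun l _ => ?_
      simp only [Pi.add_apply, Pi.smul_apply, smul_eq_mul]
      ring
    refine ⟨?_, ?_⟩
    · rintro x ⟨hx, hx1⟩ y ⟨hy, hy1⟩ s t hs ht hst
      refine ⟨⟨fun l j => ?_, fun l => ?_⟩, fun j => ?_⟩
      · have := hx.1 l j
        have := hy.1 l j
        simp only [Pi.add_apply, Pi.smul_apply, smul_eq_mul]
        positivity
      · simp only [Pi.add_apply, Pi.smul_apply, smul_eq_mul]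
        rw [Finset.sum_add_distrib, ← Finset.mul_sum, ← Finset.mul_sum, hx.2, hy.2, ← add_mul,
          hst, one_mul]
      · rw [hcomb]
        rcases hs.eq_or_lt with h | h
        · subst h
          have : t = 1 := by linarith
          subst this
          linarith [hy1 j]
        · nlinarith [hx1 j, hy1 j]
    · rintro x ⟨hx, hx1⟩ y ⟨hy, hy1⟩ s t hs ht hst
      simp only [Creal_aux, smul_eq_mul]
      rw [Finset.mul_sum, Finset.mul_sum, ← Finset.sum_add_distrib]
      refine Finset.sum_le_sum fun j _ => ?_
      rw [hcomb]
      have h1 := convex_aux _ _ s t (hx1 j) (hy1 j) hs ht hst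
      have h2 := mul_le_mul_of_nonneg_left h1 (div_pos hσ (hhb j)).le
      refine h2.trans (le_of_eq ?_)
      ring
  · intro m hm hne m' hm'
    have hlt : ∀ j, cong γ m j < 1 := by
      by_contra! hc
      obtain ⟨j, hj⟩ := hc
      obtain ⟨l, hl⟩ := cong_pos_aux γ hγ m j (by linarith)
      have hall : ∀ k, 1 ≤ cong γ m k := by
        intro k
        by_contra! hk
        have h := hne l j k hl
        rw [cbar_aux σ2 γ hb m l k hk] at h
        unfold cbarE at h
        rw [if_neg (not_lt.2 hj)] at h
        exact absurd h (not_le.2 ENNReal.ofReal_lt_top)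
      have h1 : ∑ _k : N, (1 : ℝ) ≤ ∑ k, cong γ m k := Finset.sum_le_sum fun k _ => hall k
      rw [cong_sum_aux γ Ml m hm] at h1
      simp at h1
      linarith
    by_cases hlt' : ∀ j, cong γ m' j < 1
    swap
    · push Not at hlt'
      obtain ⟨j, hj⟩ := hlt'
      rw [CsysE_top_aux σ2 γ hγ _ m' j hj]
      exact le_top
    rw [CsysE_aux σ2 hσ γ Ml hγ hb hhb m hm hlt, CsysE_aux σ2 hσ γ Ml hγ hb hhb m' hm' hlt']
    apply ENNReal.ofReal_le_ofReal
    rw [Creal_aux, Creal_aux]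
    rcases isEmpty_or_nonempty N with hN | hN
    · simp
    set p : N → ℝ := fun j => σ2 / hb j * (1 / (1 - cong γ m j) ^ 2) with hp
    have hp0 : ∀ j, 0 ≤ p j := fun j => by
      have := hhb j
      simp only [hp]
      positivity
    obtain ⟨k, hk⟩ := Finite.exists_min p
    have hpm : ∀ j, p j * cong γ m j = p k * cong γ m j := by
      intro j
      rcases (cong_nonneg_aux γ Ml hγ m hm j).eq_or_lt with h | h
      · rw [← h]; simp
      · obtain ⟨l, hl⟩ := cong_pos_aux γ hγ m j h
        have h1 := hne l j k hl
        rw [cbar_aux σ2 γ hb m l k (hlt k), cbar_aux σ2 γ hb m l j (hlt j),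
          ENNReal.ofReal_le_ofReal_iff (mul_nonneg (hγ l).le (hp0 k))] at h1
        have h2 : p j ≤ p k := le_of_mul_le_mul_left h1 (hγ l)
        rw [le_antisymm h2 (hk j)]
    have hsum : ∑ j, p j * cong γ m j ≤ ∑ j, p j * cong γ m' j := by
      calc ∑ j, p j * cong γ m j = p k * ∑ j, cong γ m j := by
            rw [Finset.mul_sum]
            exact Finset.sum_congr rfl fun j _ => hpm j
        _ = ∑ j, p k * cong γ m' j := by
            rw [cong_sum_aux γ Ml m hm, ← cong_sum_aux γ Ml m' hm', Finset.mul_sum]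
        _ ≤ _ := Finset.sum_le_sum fun j _ =>
            mul_le_mul_of_nonneg_right (hk j) (cong_nonneg_aux γ Ml hγ m' hm' j)
    have htan : ∑ j, (σ2 / hb j * (cong γ m j / (1 - cong γ m j))
          + (p j * cong γ m' j - p j * cong γ m j))
        ≤ ∑ j, σ2 / hb j * (cong γ m' j / (1 - cong γ m' j)) := by
      refine Finset.sum_le_sum fun j _ => ?_
      have h2 := mul_le_mul_of_nonneg_left (tangent_aux _ _ (hlt j) (hlt' j))
        (div_pos hσ (hhb j)).le
      refine le_trans (le_of_eq ?_) h2
      simp only [hp]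
      ring
    rw [Finset.sum_add_distrib, Finset.sum_sub_distrib] at htan
    linarith
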